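/- Along any solution of the Newtonian N-body problem (N ≥ 2) on [t₀, t*) that undergoes total collapse at time t* (all positions r_j(t) converge to a common point p ∈ ℝ³ as t → t*⁻), the second derivative of the moment of inertia tends to +∞: Ï(t) → +∞ as t → t*⁻. -/

import Mathlib

open scoped InnerProductSpace

section InnerProduct

variable {E : Type*} [NormedAddCommGroup E] [InnerProductSpace ℝ E]

/-- Symmetrization of the power of central pair forces with symmetric coefficients. -/
theorem sum_inner_sum_smul_sub_of_symm {ι : Type*} [Fintype ι] (c : ι → ι → ℝ)
    (hc : ∀ j k, c j k = c k j) (x w : ι → E) :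
    ∑ j, ⟪w j, ∑ k, c j k • (x k - x j)⟫_ℝ =
      -((1 / 2) * ∑ j, ∑ k, c j k * ⟪x k - x j, w k - w j⟫_ℝ) := by
  have hexpand : ∑ j, ⟪w j, ∑ k, c j k • (x k - x j)⟫_ℝ =
      ∑ j, ∑ k, c j k * ⟪x k - x j, w j⟫_ℝ := by
    simp only [inner_sum, real_inner_smul_right, real_inner_comm]
  have hswap : ∑ j, ∑ k, c j k * ⟪x k - x j, w k⟫_ℝ =
      -∑ j, ∑ k, c j k * ⟪x k - x j, w j⟫_ℝ := by
    rw [Finset.sum_comm, ← Finset.sum_neg_distrib]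
    refine Finset.sum_congr rfl fun j _ => ?_
    rw [← Finset.sum_neg_distrib]
    refine Finset.sum_congr rfl fun k _ => ?_
    rw [hc k j, ← neg_sub (x k) (x j), inner_neg_left, mul_neg]
  have hsub : ∑ j, ∑ k, c j k * ⟪x k - x j, w k - w j⟫_ℝ =
      ∑ j, ∑ k, c j k * ⟪x k - x j, w k⟫_ℝ - ∑ j, ∑ k, c j k * ⟪x k - x j, w j⟫_ℝ := by
    simp only [inner_sub_right _ (w _) (w _), mul_sub, Finset.sum_sub_distrib]
  rw [hexpand, hsub, hswap]
  ring

/-- The derivative of the reciprocal of the norm along a curve avoiding the origin. -/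
theorem HasDerivWithinAt.inv_norm {x : ℝ → E} {x' : E} {s : Set ℝ} {t : ℝ}
    (hx : HasDerivWithinAt x x' s t) (h0 : x t ≠ 0) :
    HasDerivWithinAt (fun u => ‖x u‖⁻¹) (-(⟪x t, x'⟫_ℝ / ‖x t‖ ^ 3)) s t := by
  have hpos : 0 < ‖x t‖ := norm_pos_iff.mpr h0
  have hsqrt := (hx.norm_sq.sqrt (by positivity)).inv (by positivity)
  simp only [Real.sqrt_sq (norm_nonneg _)] at hsqrt
  refine HasDerivWithinAt.congr_deriv (f := fun u => ‖x u‖⁻¹) hsqrt ?_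
  field_simp

end InnerProduct

/-- Along any solution of the Newtonian N-body problem (`N ≥ 2`) on `[t₀, t*)`
undergoing total collapse at `t*`, the second derivative of the moment of
inertia tends to `+∞` as `t → t*⁻`. -/
theorem total_collapse_inertia_blowup (N : ℕ) (hN : 2 ≤ N)
    (m : Fin N → ℝ) (hm : ∀ j, 0 < m j) (G : ℝ) (hG : 0 < G)
    (t₀ tstar : ℝ) (ht : t₀ < tstar)
    (r v a : Fin N → ℝ → EuclideanSpace ℝ (Fin 3))
    (hrv : ∀ j, ∀ t ∈ Set.Ico t₀ tstar,
      HasDerivWithinAt (r j) (v j t) (Set.Ico t₀ tstar) t)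
    (hva : ∀ j, ∀ t ∈ Set.Ico t₀ tstar,
      HasDerivWithinAt (v j) (a j t) (Set.Ico t₀ tstar) t)
    (hacont : ∀ j, ContinuousOn (a j) (Set.Ico t₀ tstar))
    (hsep : ∀ t ∈ Set.Ico t₀ tstar, ∀ j k, j ≠ k → r j t ≠ r k t)
    (hNewton : ∀ j, ∀ t ∈ Set.Ico t₀ tstar,
      m j • a j t = ∑ k ∈ Finset.univ.erase j,
        (G * m j * m k / ‖r k t - r j t‖ ^ 3) • (r k t - r j t))
    (p : EuclideanSpace ℝ (Fin 3))
    (hcollapse : ∀ j, Filter.Tendsto (r j) (nhdsWithin tstar (Set.Iio tstar)) (nhds p))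
    (I : ℝ → ℝ) (hI : ∀ t, I t = (1 / 2) * ∑ j, m j * ‖r j t‖ ^ 2)
    (I' I'' : ℝ → ℝ)
    (hI' : ∀ t ∈ Set.Ico t₀ tstar, HasDerivWithinAt I (I' t) (Set.Ico t₀ tstar) t)
    (hI'' : ∀ t ∈ Set.Ico t₀ tstar, HasDerivWithinAt I' (I'' t) (Set.Ico t₀ tstar) t) :
    Filter.Tendsto I'' (nhdsWithin tstar (Set.Iio tstar)) Filter.atTop := by
  set S := Set.Ico t₀ tstar
  set U : ℝ → ℝ := fun t => (1 / 2) * ∑ j, ∑ k, G * m j * m k * ‖r k t - r j t‖⁻¹ with hU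
  set K : ℝ → ℝ := fun t => (1 / 2) * ∑ j, m j * ‖v j t‖ ^ 2 with hK
  have hforce : ∀ j, ∀ t ∈ S, m j • a j t =
      ∑ k, (G * m j * m k / ‖r k t - r j t‖ ^ 3) • (r k t - r j t) := by
    intro j t htS
    rw [hNewton j t htS]
    exact Finset.sum_erase _ (by simp)
  have hpower : ∀ w : Fin N → EuclideanSpace ℝ (Fin 3), ∀ t ∈ S, ∑ j, m j * ⟪w j, a j t⟫_ℝ =
      -((1 / 2) * ∑ j, ∑ k, G * m j * m k / ‖r k t - r j t‖ ^ 3 *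
        ⟪r k t - r j t, w k - w j⟫_ℝ) := by
    intro w t htS
    rw [← sum_inner_sum_smul_sub_of_symm
      (fun j k => G * m j * m k / ‖r k t - r j t‖ ^ 3)
      (fun j k => by rw [norm_sub_rev, mul_right_comm]) (fun j => r j t) w]
    refine Finset.sum_congr rfl fun j _ => ?_
    rw [← hforce j t htS, real_inner_smul_right]
  have hvirial : ∀ t ∈ S, ∑ j, m j * ⟪r j t, a j t⟫_ℝ = -U t := by
    intro t htS
    rw [hpower (fun j => r j t) t htS, hU]
    congr 2
    refine Finset.sum_congr rfl fun j _ => Finset.sum_congr rfl fun k _ => ?_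
    rw [real_inner_self_eq_norm_sq]
    by_cases hjk : ‖r k t - r j t‖ = 0
    · simp [hjk]
    · field_simp
  have hU' : ∀ t ∈ S, HasDerivWithinAt U (∑ j, m j * ⟪v j t, a j t⟫_ℝ) S t := by
    intro t htS
    rw [hpower (fun j => v j t) t htS, ← mul_neg, ← Finset.sum_neg_distrib]
    simp only [← Finset.sum_neg_distrib]
    refine HasDerivWithinAt.const_mul _ <| HasDerivWithinAt.fun_sum fun j _ =>
      HasDerivWithinAt.fun_sum fun k _ => ?_
    by_cases hjk : j = k
    · subst hjk
      simpa using hasDerivWithinAt_const t S (0 : ℝ)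
    · refine ((((hrv k t htS).fun_sub (hrv j t htS)).inv_norm
        (sub_ne_zero.mpr (hsep t htS k j (Ne.symm hjk)))).const_mul (G * m j * m k)).congr_deriv ?_
      ring
  have hK' : ∀ t ∈ S, HasDerivWithinAt K (∑ j, m j * ⟪v j t, a j t⟫_ℝ) S t := by
    intro t htS
    refine ((HasDerivWithinAt.fun_sum fun j _ =>
      ((hva j t htS).norm_sq.const_mul (m j))).const_mul (1 / 2 : ℝ)).congr_deriv ?_
    rw [Finset.mul_sum]
    exact Finset.sum_congr rfl fun j _ => by ring
  have henergy : ∀ t ∈ S, K t - U t = K t₀ - U t₀ := by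
    intro t htS
    have hd : ∀ u ∈ S, HasDerivWithinAt (fun u => K u - U u) 0 S u := fun u hu =>
      ((hK' u hu).fun_sub (hU' u hu)).congr_deriv (sub_self _)
    refine constant_of_has_deriv_right_zero (f := fun u => K u - U u) (a := t₀) (b := t)
      (fun u hu => ?_) (fun u hu => ?_) t ⟨htS.1, le_rfl⟩
    · exact (hd u ⟨hu.1, hu.2.trans_lt htS.2⟩).continuousWithinAt.mono
        fun y hy => ⟨hy.1, hy.2.trans_lt htS.2⟩
    · have huS : u ∈ S := ⟨hu.1, hu.2.trans htS.2⟩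
      exact (hd u huS).mono_of_mem_nhdsWithin
        (Filter.mem_of_superset (Ico_mem_nhdsGE huS.2) fun y hy => ⟨hu.1.trans hy.1, hy.2⟩)
  have hunique : UniqueDiffOn ℝ S := uniqueDiffOn_Ico t₀ tstar
  have hI'_eq : ∀ t ∈ S, I' t = ∑ j, m j * ⟪r j t, v j t⟫_ℝ := by
    intro t htS
    refine (hunique t htS).eq_deriv S (hI' t htS) ?_
    rw [funext hI]
    refine ((HasDerivWithinAt.fun_sum fun j _ =>
      ((hrv j t htS).norm_sq.const_mul (m j))).const_mul (1 / 2 : ℝ)).congr_deriv ?_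
    rw [Finset.mul_sum]
    exact Finset.sum_congr rfl fun j _ => by ring
  have hI''_eq : ∀ t ∈ S, I'' t = U t + 2 * (K t₀ - U t₀) := by
    intro t htS
    have hderiv : HasDerivWithinAt I' (2 * K t - U t) S t := by
      refine HasDerivWithinAt.congr (f := fun t => ∑ j, m j * ⟪r j t, v j t⟫_ℝ) ?_
        hI'_eq (hI'_eq t htS)
      refine (HasDerivWithinAt.fun_sum fun j _ =>
        (((hrv j t htS).inner ℝ (hva j t htS)).const_mul (m j))).congr_deriv ?_
      simp only [mul_add, Finset.sum_add_distrib, real_inner_self_eq_norm_sq]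
      rw [hvirial t htS, hK]
      ring
    rw [(hunique t htS).eq_deriv S (hI'' t htS) hderiv, ← henergy t htS]
    ring
  have hmem : ∀ᶠ t in nhdsWithin tstar (Set.Iio tstar), t ∈ S := Ico_mem_nhdsLT ht
  have hUtop : Filter.Tendsto U (nhdsWithin tstar (Set.Iio tstar)) Filter.atTop := by
    let i : Fin N := ⟨0, by omega⟩
    let l : Fin N := ⟨1, by omega⟩
    have hil : i ≠ l := by simp [i, l]
    have hdist : Filter.Tendsto (fun t => ‖r l t - r i t‖)
        (nhdsWithin tstar (Set.Iio tstar)) (nhdsWithin 0 (Set.Ioi 0)) := by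
      refine tendsto_nhdsWithin_iff.mpr ⟨?_, ?_⟩
      · simpa using ((hcollapse l).sub (hcollapse i)).norm
      · filter_upwards [hmem] with t htS
        exact norm_pos_iff.mpr (sub_ne_zero.mpr (hsep t htS l i hil.symm))
    have hcoeff : 0 < (1 / 2) * (G * m i * m l) := by
      have := hm i
      have := hm l
      positivity
    refine Filter.tendsto_atTop_mono (fun t => ?_)
      ((tendsto_inv_nhdsGT_zero.comp hdist).const_mul_atTop hcoeff)
    have hnonneg : ∀ j k, 0 ≤ G * m j * m k * ‖r k t - r j t‖⁻¹ := by
      intro j k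
      have := hm j
      have := hm k
      positivity
    have hterm : G * m i * m l * ‖r l t - r i t‖⁻¹ ≤
        ∑ j, ∑ k, G * m j * m k * ‖r k t - r j t‖⁻¹ :=
      (Finset.single_le_sum (f := fun k => G * m i * m k * ‖r k t - r i t‖⁻¹)
        (fun k _ => hnonneg i k) (Finset.mem_univ l)).trans
      (Finset.single_le_sum (f := fun j => ∑ k, G * m j * m k * ‖r k t - r j t‖⁻¹)
        (fun j _ => Finset.sum_nonneg fun k _ => hnonneg j k) (Finset.mem_univ i))
    simp only [Function.comp_apply, hU]
    linarith
  refine (Filter.tendsto_atTop_add_const_right _ (2 * (K t₀ - U t₀)) hUtop).congr' ?_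
  filter_upwards [hmem] with t htS
  exact (hI''_eq t htS).symm
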